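/- Suppose (VU)^2 = G_1⋯G_r where each G_i is a conjugate of U in SL(2,ℤ). Then r ≥ 4, and a finite sequence of Hurwitz moves transforms the sequence (G_1,…,G_r) into a sequence (V, U, V, U, D_5,…,D_r) with D_5⋯D_r = Id (the 2×2 identity matrix). -/

import Mathlib

/-- `SL(2,ℤ)`, the group of 2×2 integer matrices of determinant 1. -/
abbrev SL2Z := Matrix.SpecialLinearGroup (Fin 2) ℤ

/-- The matrix `U = [[1,1],[0,1]]`. -/
def U : SL2Z := ⟨!![1, 1; 0, 1], by norm_num [Matrix.det_fin_two_of]⟩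

/-- The matrix `V = [[1,0],[-1,1]]`. -/
def V : SL2Z := ⟨!![1, 0; -1, 1], by norm_num [Matrix.det_fin_two_of]⟩

/-- A single Hurwitz move on a finite sequence of elements of a group: some consecutive
pair `(a, b)` is replaced by `(b, b⁻¹ * a * b)` or by `(a * b * a⁻¹, a)`. -/
def HurwitzMove {G : Type*} [Group G] (L L' : List G) : Prop :=
  ∃ (p : List G) (a b : G) (t : List G),
    L = p ++ a :: b :: t ∧
    (L' = p ++ b :: (b⁻¹ * a * b) :: t ∨ L' = p ++ (a * b * a⁻¹) :: a :: t)

/-- A finite sequence of Hurwitz moves. -/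
def HurwitzEquiv {G : Type*} [Group G] : List G → List G → Prop :=
  Relation.ReflTransGen HurwitzMove

namespace HurwitzEquiv

variable {G H : Type*} [Group G] [Group H]

theorem swap_right (a b : G) (t : List G) :
    HurwitzEquiv (a :: b :: t) (b :: (b⁻¹ * a * b) :: t) :=
  .single ⟨[], a, b, t, rfl, .inl rfl⟩

theorem swap_left (a b : G) (t : List G) :
    HurwitzEquiv (a :: b :: t) ((a * b * a⁻¹) :: a :: t) :=
  .single ⟨[], a, b, t, rfl, .inr rfl⟩

theorem append_left (p : List G) {L L' : List G} (h : HurwitzEquiv L L') :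
    HurwitzEquiv (p ++ L) (p ++ L') := by
  refine Relation.ReflTransGen.lift (p ++ ·) (fun _ _ hm => ?_) _ _ h
  obtain ⟨q, a, b, t, rfl, rfl | rfl⟩ := hm
  · exact ⟨p ++ q, a, b, t, by simp, .inl (by simp)⟩
  · exact ⟨p ++ q, a, b, t, by simp, .inr (by simp)⟩

theorem cons (a : G) {L L' : List G} (h : HurwitzEquiv L L') :
    HurwitzEquiv (a :: L) (a :: L') :=
  append_left [a] h

theorem map (f : G →* H) {L L' : List G} (h : HurwitzEquiv L L') :
    HurwitzEquiv (L.map f) (L'.map f) := by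
  refine Relation.ReflTransGen.lift (List.map f) (fun _ _ hm => ?_) _ _ h
  obtain ⟨q, a, b, t, rfl, rfl | rfl⟩ := hm
  · exact ⟨q.map f, f a, f b, t.map f, by simp, .inl (by simp)⟩
  · exact ⟨q.map f, f a, f b, t.map f, by simp, .inr (by simp)⟩

theorem prod_eq {L L' : List G} (h : HurwitzEquiv L L') : L'.prod = L.prod := by
  induction h with
  | refl => rfl
  | tail _ h ih =>
    rw [← ih]
    obtain ⟨q, a, b, t, rfl, rfl | rfl⟩ := h <;> simp [mul_assoc]

theorem length_eq {L L' : List G} (h : HurwitzEquiv L L') : L'.length = L.length := by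
  induction h with
  | refl => rfl
  | tail _ h ih =>
    rw [← ih]
    obtain ⟨q, a, b, t, rfl, rfl | rfl⟩ := h <;> simp

theorem forall_isConj {c : G} {L L' : List G} (h : HurwitzEquiv L L')
    (hL : ∀ A ∈ L, IsConj c A) : ∀ A ∈ L', IsConj c A := by
  induction h with
  | refl => exact hL
  | tail _ h ih =>
    obtain ⟨q, a, b, t, rfl, rfl | rfl⟩ := h
    · have hab : IsConj a (b⁻¹ * a * b) := isConj_iff.2 ⟨b⁻¹, by simp⟩
      have ha := (ih a (by simp)).trans hab
      intro A hA
      simp only [List.mem_append, List.mem_cons] at hA ih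
      rcases hA with h | rfl | rfl | h
      exacts [ih _ (.inl h), ih _ (by simp), ha, ih _ (by simp [h])]
    · have hab : IsConj b (a * b * a⁻¹) := isConj_iff.2 ⟨a, rfl⟩
      have hb := (ih b (by simp)).trans hab
      intro A hA
      simp only [List.mem_append, List.mem_cons] at hA ih
      rcases hA with h | rfl | rfl | h
      exacts [ih _ (.inl h), hb, ih _ (by simp), ih _ (by simp [h])]

theorem exists_move_to_front (p : List G) (g : G) (t : List G) :
    ∃ p', HurwitzEquiv (p ++ g :: t) (g :: p' ++ t) := by
  induction p with
  | nil => exact ⟨[], .refl⟩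
  | cons a p ih =>
    obtain ⟨p', h⟩ := ih
    exact ⟨(g⁻¹ * a * g) :: p', (h.cons a).trans (swap_right a g _)⟩

theorem exists_pair_to_front (p : List G) (g h : G) (t : List G) :
    ∃ D, HurwitzEquiv (p ++ g :: h :: t) (g :: h :: D) := by
  obtain ⟨p', h₁⟩ := exists_move_to_front p g (h :: t)
  obtain ⟨p'', h₂⟩ := exists_move_to_front p' h t
  exact ⟨p'' ++ t, h₁.trans (h₂.cons g)⟩

end HurwitzEquiv

theorem List.exists_append_of_not_isChain {α : Type*} {r : α → α → Prop} {l : List α}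
    (h : ¬ l.IsChain r) : ∃ p a b t, l = p ++ a :: b :: t ∧ ¬ r a b := by
  induction l with
  | nil => simp at h
  | cons a l ih =>
    cases l with
    | nil => simp at h
    | cons b l =>
      by_cases hab : r a b
      · obtain ⟨p, c, d, t, hl, hcd⟩ := ih (fun hc => h (hc.cons_cons hab))
        exact ⟨a :: p, c, d, t, by simp [hl], hcd⟩
      · exact ⟨[], a, b, l, rfl, hab⟩

namespace SL2Z

/-- The rotation `UV` of order six, which fixes the base triangle of the Farey tessellation. -/
def rot : SL2Z := U * V

/-- The conjugate `UVU⁻¹` of `U`, which fixes the vector `(1, 1)`. -/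
def shear : SL2Z := U * V * U⁻¹

theorem coe_U : (↑U : Matrix (Fin 2) (Fin 2) ℤ) = !![1, 1; 0, 1] := rfl

theorem coe_V : (↑V : Matrix (Fin 2) (Fin 2) ℤ) = !![1, 0; -1, 1] := rfl

theorem braid : U * V * U = V * U * V := by
  ext i j; fin_cases i <;> fin_cases j <;> simp [coe_U, coe_V]

theorem braid_eq_neg : V * U * V * U * V = -U⁻¹ := by
  ext i j; fin_cases i <;> fin_cases j <;> simp [coe_U, coe_V, Matrix.adjugate_fin_two]

theorem rot_pow_three : rot ^ 3 = -1 := by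
  have h : rot ^ 3 = U * (V * U * V * U * V) := by simp only [rot, pow_succ]; group
  rw [h, braid_eq_neg]; simp

theorem rot_sq : rot ^ 2 = -rot⁻¹ := by
  have h := rot_pow_three
  rw [pow_succ] at h
  rw [eq_mul_inv_of_mul_eq h]; simp

/-- The subgroup generated by `rot`. -/
abbrev rotations : Subgroup SL2Z := Subgroup.zpowers rot

theorem rot_mem : rot ∈ rotations := Subgroup.mem_zpowers rot

theorem neg_one_mem : (-1 : SL2Z) ∈ rotations :=
  rot_pow_three ▸ pow_mem rot_mem 3

theorem rotations_cases {ρ : SL2Z} (h : ρ ∈ rotations) :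
    (ρ = 1 ∨ ρ = rot ∨ ρ = rot⁻¹) ∨ (ρ = -1 ∨ ρ = -rot ∨ ρ = -rot⁻¹) := by
  obtain ⟨k, rfl⟩ := h
  have h₆ : rot ^ 6 = 1 := by rw [show 6 = 3 * 2 from rfl, pow_mul, rot_pow_three]; simp
  have h₄ : rot ^ 4 = -rot := by rw [pow_succ, rot_pow_three]; simp
  have h₅ : rot ^ 5 = rot⁻¹ := eq_inv_of_mul_eq_one_left (by rw [← pow_succ, h₆])
  dsimp only
  rw [zpow_eq_zpow_emod (n := 6) k (mod_cast h₆)]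
  have h0 := Int.emod_nonneg k (show (6 : ℤ) ≠ 0 by norm_num)
  have h1 := Int.emod_lt_of_pos k (show (0 : ℤ) < 6 by norm_num)
  generalize k % 6 = m at h0 h1
  lift m to ℕ using h0
  rw [zpow_natCast]
  have : m < 6 := by exact_mod_cast h1
  interval_cases m <;> simp [rot_sq, rot_pow_three, h₄, h₅]

theorem U_mul_rot : U * rot = rot * shear := by
  have := braid
  simp only [rot, shear]
  rw [eq_comm, ← mul_assoc, mul_inv_eq_iff_eq_mul]
  simp only [mul_assoc] at *
  rw [this]

theorem rot_conj_shear : rot * shear * rot⁻¹ = U := by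
  rw [← U_mul_rot]; group

theorem rot_inv_conj_shear : rot⁻¹ * shear * rot = V := by
  simp only [rot, shear]; group

theorem V_inv_conj_U : V⁻¹ * U * V = shear := by
  have := braid
  simp only [shear]
  rw [mul_assoc, inv_mul_eq_iff_eq_mul, ← mul_assoc, ← mul_assoc, ← this]; group

/-- The generators `U` and `V⁻¹` of the monoid of nonnegative matrices. -/
def letter : Bool → SL2Z
  | true => U
  | false => V⁻¹

/-- The product of a word in the letters `U` and `V⁻¹`. -/
def word (w : List Bool) : SL2Z := (w.map letter).prod

@[simp] theorem word_nil : word [] = 1 := rfl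

@[simp] theorem word_cons (c : Bool) (w : List Bool) : word (c :: w) = letter c * word w := by
  simp [word]

@[simp] theorem word_append (w s : List Bool) : word (w ++ s) = word w * word s := by
  simp [word]

/-- The conjugate of `shear` by `N`. -/
def conjShear (N : SL2Z) : SL2Z := N * shear * N⁻¹

theorem conjShear_mul (g N : SL2Z) : conjShear (g * N) = g * conjShear N * g⁻¹ := by
  simp only [conjShear]; group

@[simp] theorem conjShear_neg (N : SL2Z) : conjShear (-N) = conjShear N := by
  have : (-N)⁻¹ = -N⁻¹ := by rw [inv_eq_iff_mul_eq_one]; simp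
  simp [conjShear, this]

/-- `HasDepth n G`: the line of the Farey tree translated by `G` is at distance at most `n` from
the base vertex. -/
def HasDepth (n : ℕ) (G : SL2Z) : Prop :=
  ∃ ρ ∈ rotations, ∃ w : List Bool, w.length ≤ n ∧ G = conjShear (ρ * word w)

theorem HasDepth.mono {m n : ℕ} {G : SL2Z} (h : HasDepth m G) (hmn : m ≤ n) : HasDepth n G := by
  obtain ⟨ρ, hρ, w, hw, rfl⟩ := h
  exact ⟨ρ, hρ, w, hw.trans hmn, rfl⟩

theorem conjShear_letter_mul (c : Bool) {ε : SL2Z} (hε : ε = rot ∨ ε = rot⁻¹) :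
    conjShear (letter c * ε) = conjShear ε ∨ conjShear (letter c * ε) = conjShear 1 := by
  have h₁ : conjShear rot = U := rot_conj_shear
  have h₂ : conjShear rot⁻¹ = V := by simpa [conjShear] using rot_inv_conj_shear
  have h₃ : V⁻¹ * U * V⁻¹⁻¹ = shear := by simpa using V_inv_conj_U
  rcases hε with rfl | rfl <;> cases c <;> simp only [conjShear_mul, h₁, h₂, letter]
  · exact .inr (by simpa [conjShear] using h₃)
  · exact .inl (by group)
  · exact .inl (by group)
  · exact .inr (by simp [conjShear, shear])

theorem turn_mul_letter {ε : SL2Z} (hε : ε = rot ∨ ε = rot⁻¹) (d : Bool) :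
    (∃ d', ε * letter d = letter d') ∨
      ∀ c, ∃ ε', (ε' = rot ∨ ε' = rot⁻¹) ∧
        (letter c * ε * letter d = ε' ∨ letter c * ε * letter d = -ε') := by
  have hb := braid
  have hsq := rot_sq
  have hinv : rot⁻¹ * rot⁻¹ = -rot := by
    rw [← mul_inv_rev, ← pow_two, hsq, inv_eq_iff_mul_eq_one]; simp
  rcases hε with rfl | rfl <;> cases d
  · exact .inl ⟨true, by simp [letter, rot]⟩
  · refine .inr fun c => ?_
    cases c
    · refine ⟨rot, .inl rfl, .inl ?_⟩
      simp only [letter, rot]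
      rw [mul_assoc, inv_mul_eq_iff_eq_mul, hb]; group
    · refine ⟨rot⁻¹, .inr rfl, .inr ?_⟩
      rw [← hsq]
      simp only [letter, rot, mul_assoc, pow_two] at *
      rw [hb]
  · refine .inr fun c => ?_
    cases c
    · refine ⟨rot, .inl rfl, .inr ?_⟩
      rw [← hinv]
      have h : V⁻¹ * U⁻¹ * V⁻¹ = U⁻¹ * V⁻¹ * U⁻¹ := by
        simpa [mul_assoc] using (congrArg (·⁻¹) hb).symm
      simp only [letter, rot, mul_inv_rev, mul_assoc] at *
      rw [h]
    · refine ⟨rot⁻¹, .inr rfl, .inl ?_⟩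
      have h : V⁻¹ * U⁻¹ * V⁻¹ = U⁻¹ * V⁻¹ * U⁻¹ := by
        simpa [mul_assoc] using (congrArg (·⁻¹) hb).symm
      simp only [letter, rot, mul_inv_rev]
      rw [mul_assoc, h]; group
  · exact .inl ⟨false, by simp [letter, rot]⟩

/-- Turning at a vertex at the end of the path `w` cannot increase the depth. -/
theorem hasDepth_turn (w : List Bool) : ∀ (s : List Bool) (ρ ε : SL2Z), ρ ∈ rotations →
    (ε = rot ∨ ε = rot⁻¹) →
    HasDepth (w.length + s.length) (conjShear (ρ * word w * ε * word s)) := by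
  induction w using List.reverseRecOn with
  | nil =>
    rintro s ρ ε hρ hε
    refine ⟨ρ * ε, mul_mem hρ ?_, s, by simp, by simp⟩
    rcases hε with rfl | rfl
    exacts [rot_mem, inv_mem rot_mem]
  | append_singleton w c ih =>
    rintro (_ | ⟨d, s⟩) ρ ε hρ hε
    · have e : conjShear (ρ * word (w ++ [c]) * ε * word []) =
          ρ * word w * conjShear (letter c * ε) * (ρ * word w)⁻¹ := by
        rw [← conjShear_mul]; simp [mul_assoc]
      rw [e]
      rcases conjShear_letter_mul c hε with h | h <;> rw [h, ← conjShear_mul]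
      · simpa using (ih [] ρ ε hρ hε).mono (n := w.length + 1) (by simp)
      · exact ⟨ρ, hρ, w, by simp, by simp⟩
    · have e : ρ * word (w ++ [c]) * ε * word (d :: s) =
          ρ * word w * (letter c * ε * letter d) * word s := by simp [mul_assoc]
      rcases turn_mul_letter hε d with ⟨d', h⟩ | h
      · refine ⟨ρ, hρ, w ++ c :: d' :: s, by simp; omega, ?_⟩
        rw [e, mul_assoc (letter c), h]; simp [mul_assoc]
      · obtain ⟨ε', hε', h⟩ := h c
        have := (ih s ρ ε' hρ hε').mono (n := (w ++ [c]).length + (d :: s).length)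
          (by simp; omega)
        rcases h with h | h <;> rw [e, h]
        · exact this
        · simpa using this

/-! ### Every conjugate of `U` has a depth -/

theorem hasDepth_conj_rot {ρ G : SL2Z} {n : ℕ} (hρ : ρ ∈ rotations) (h : HasDepth n G) :
    HasDepth n (ρ * G * ρ⁻¹) := by
  obtain ⟨σ, hσ, w, hw, rfl⟩ := h
  exact ⟨ρ * σ, mul_mem hρ hσ, w, hw, by rw [mul_assoc ρ σ, conjShear_mul ρ]⟩

theorem hasDepth_conj_U {G : SL2Z} {n : ℕ} (h : HasDepth n G) :
    HasDepth (n + 1) (U * G * U⁻¹) := by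
  obtain ⟨σ, hσ, w, hw, rfl⟩ := h
  rw [← conjShear_mul]
  have h₁ : HasDepth (n + 1) (conjShear (U * word w)) :=
    ⟨1, one_mem _, true :: w, by simpa using hw, by simp [letter]⟩
  have h₂ (ε : SL2Z) (hε : ε = rot ∨ ε = rot⁻¹) :
      HasDepth (n + 1) (conjShear (U * (ε * word w))) := by
    have := (hasDepth_turn [true] w 1 ε (one_mem _) hε).mono (n := n + 1) (by simp; omega)
    simpa [letter, mul_assoc] using this
  rcases rotations_cases hσ with (rfl | rfl | rfl) | (rfl | rfl | rfl)
  · simpa using h₁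
  · exact h₂ _ (.inl rfl)
  · exact h₂ _ (.inr rfl)
  · simpa using h₁
  · simpa using h₂ _ (.inl rfl)
  · simpa using h₂ _ (.inr rfl)

theorem U_inv_eq : U⁻¹ = -(rot * U * rot) := by
  have h : U⁻¹ = -(V * U * V * U * V) := by rw [braid_eq_neg, neg_neg]
  rw [h, ← braid]
  simp only [rot, mul_assoc]

theorem exists_hasDepth_conj (N : SL2Z) :
    ∀ G, (∃ n, HasDepth n G) → ∃ n, HasDepth n (N * G * N⁻¹) := by
  let P (N : SL2Z) : Prop := ∀ G, (∃ n, HasDepth n G) → ∃ n, HasDepth n (N * G * N⁻¹)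
  have hmul {M N : SL2Z} (hM : P M) (hN : P N) : P (M * N) := fun G hG => by
    simpa [mul_assoc] using hM _ (hN _ hG)
  have hrot {ρ : SL2Z} (h : ρ ∈ rotations) : P ρ := fun G ⟨n, hG⟩ =>
    ⟨n, hasDepth_conj_rot h hG⟩
  have hU : P U := fun G ⟨n, hG⟩ => ⟨n + 1, hasDepth_conj_U hG⟩
  have hU' : P U⁻¹ := by
    have e : U⁻¹ = -1 * (rot * U * rot) := by rw [U_inv_eq]; simp
    rw [e]
    exact hmul (hrot neg_one_mem) (hmul (hmul (hrot rot_mem) hU) (hrot rot_mem))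
  have hT : ModularGroup.T = U := by
    ext i j; fin_cases i <;> fin_cases j <;> simp [coe_U, ModularGroup.T]
  have hS : ModularGroup.S = -1 * (rot * U) := by
    ext i j; fin_cases i <;> fin_cases j <;> simp [coe_U, coe_V, rot, ModularGroup.S]
  have hS' : ModularGroup.S⁻¹ = U⁻¹ * rot⁻¹ * (-1 : SL2Z)⁻¹ := by rw [hS]; group
  have h : P N ∧ P N⁻¹ := by
    have hN : N ∈ Subgroup.closure {ModularGroup.S, ModularGroup.T} := by
      rw [SpecialLinearGroup.SL2Z_generators]; trivial
    induction hN using Subgroup.closure_induction with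
    | mem x hx =>
      rcases hx with rfl | rfl
      · refine ⟨?_, ?_⟩
        · rw [hS]; exact hmul (hrot neg_one_mem) (hmul (hrot rot_mem) hU)
        · rw [hS']
          exact hmul (hmul hU' (hrot (inv_mem rot_mem))) (hrot (inv_mem neg_one_mem))
      · rw [hT]; exact ⟨hU, hU'⟩
    | one => exact ⟨hrot (one_mem _), by simpa using hrot (one_mem _)⟩
    | mul x y _ _ hx hy => exact ⟨hmul hx.1 hy.1, by rw [mul_inv_rev]; exact hmul hy.2 hx.2⟩
    | inv x _ hx => exact ⟨hx.2, by simpa using hx.1⟩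
  exact h.1

theorem exists_hasDepth {G : SL2Z} (h : IsConj U G) : ∃ n, HasDepth n G := by
  obtain ⟨N, rfl⟩ := isConj_iff.1 h
  exact exists_hasDepth_conj N U ⟨0, rot, rot_mem, [], le_rfl, by simp [conjShear, rot_conj_shear]⟩

/-! ### Ping-pong -/

/-- The product of the entries of the first column: it is nonnegative exactly if this column lies,
up to sign, in the closed first quadrant. -/
def quad (M : SL2Z) : ℤ := M 0 0 * M 1 0

@[simp] theorem quad_neg (M : SL2Z) : quad (-M) = quad M := by simp [quad]

theorem quad_U_inv_mul (M : SL2Z) : quad (U⁻¹ * M) = (M 0 0 - M 1 0) * M 1 0 := by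
  simp [quad, coe_U, Matrix.mul_apply, Fin.sum_univ_two, Matrix.adjugate_fin_two, sub_eq_add_neg]

theorem quad_V_mul (M : SL2Z) : quad (V * M) = M 0 0 * (M 1 0 - M 0 0) := by
  simp [quad, coe_V, Matrix.mul_apply, Fin.sum_univ_two, sub_eq_neg_add]

theorem quad_rot_inv_mul (M : SL2Z) : quad (rot⁻¹ * M) = (M 0 0 - M 1 0) * M 0 0 := by
  simp [quad, rot, coe_U, coe_V, Matrix.mul_apply, Fin.sum_univ_two, Matrix.adjugate_fin_two,
    sub_eq_add_neg]

theorem quad_U_inv_mul_rot_inv_mul (M : SL2Z) :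
    quad (U⁻¹ * (rot⁻¹ * M)) = -(M 0 0 * M 1 0) := by
  rw [quad_U_inv_mul]
  simp [rot, coe_U, coe_V, Matrix.mul_apply, Fin.sum_univ_two, Matrix.adjugate_fin_two,
    mul_comm]

theorem quad_of_letter (c : Bool) (M : SL2Z) :
    (0 ≤ quad ((letter c)⁻¹ * M) → 0 ≤ quad M) ∧ (0 < quad ((letter c)⁻¹ * M) → 0 < quad M) := by
  cases c
  · rw [letter, inv_inv, quad_V_mul, quad]
    constructor <;> intro <;> nlinarith [sq_nonneg (M 0 0)]
  · rw [letter, quad_U_inv_mul, quad]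
    constructor <;> intro <;> nlinarith [sq_nonneg (M 1 0)]

theorem quad_of_word (w : List Bool) (M : SL2Z) :
    (0 ≤ quad ((word w)⁻¹ * M) → 0 ≤ quad M) ∧ (0 < quad ((word w)⁻¹ * M) → 0 < quad M) := by
  induction w generalizing M with
  | nil => simp
  | cons c w ih =>
    have e : (word (c :: w))⁻¹ * M = (word w)⁻¹ * ((letter c)⁻¹ * M) := by simp [mul_assoc]
    rw [e]
    exact ⟨fun h => (quad_of_letter c M).1 ((ih _).1 h),
      fun h => (quad_of_letter c M).2 ((ih _).2 h)⟩

theorem comparable_of_overlap (t t' : List Bool) (M : SL2Z) (h : 0 ≤ quad ((word t)⁻¹ * M))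
    (h' : 0 < quad ((word t')⁻¹ * M)) : t <+: t' ∨ t' <+: t := by
  induction t generalizing t' M with
  | nil => exact .inl ⟨_, rfl⟩
  | cons c t ih =>
    cases t' with
    | nil => exact .inr ⟨_, rfl⟩
    | cons c' t' =>
      rw [word_cons, mul_inv_rev, mul_assoc] at h h'
      by_cases hc : c = c'
      · subst hc
        simpa using ih t' _ h h'
      · replace h := (quad_of_word _ _).1 h
        replace h' := (quad_of_word _ _).2 h'
        exfalso
        cases c <;> cases c' <;> first | exact hc rfl | skip
        all_goals
          simp only [letter, inv_inv, quad_U_inv_mul, quad_V_mul] at h h'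
          nlinarith [sq_nonneg (M 0 0 - M 1 0)]

theorem eq_or_eq_neg_of_overlap {σ σ' : SL2Z} (hσ : σ ∈ rotations) (hσ' : σ' ∈ rotations)
    (M : SL2Z) (h : 0 ≤ quad (U⁻¹ * (σ⁻¹ * M))) (h' : 0 < quad (U⁻¹ * (σ'⁻¹ * M))) :
    σ' = σ ∨ σ' = -σ := by
  obtain ⟨τ, rfl⟩ : ∃ τ, σ' = σ * τ := ⟨σ⁻¹ * σ', by simp⟩
  obtain ⟨x, rfl⟩ : ∃ x, M = σ * τ * x := ⟨(σ * τ)⁻¹ * M, (mul_inv_cancel_left _ _).symm⟩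
  have e : σ⁻¹ * (σ * τ * x) = τ * x := by group
  rw [e] at h
  rw [inv_mul_cancel_left, quad_U_inv_mul] at h'
  have h₁ : ¬ 0 ≤ quad (U⁻¹ * (rot * x)) := by
    have : U⁻¹ * (rot * x) = V * x := by simp [rot, mul_assoc]
    rw [this, quad_V_mul]
    nlinarith [sq_nonneg (x 0 0 - x 1 0)]
  have h₂ : ¬ 0 ≤ quad (U⁻¹ * (rot⁻¹ * x)) := by
    rw [quad_U_inv_mul_rot_inv_mul]
    nlinarith [sq_nonneg (x 1 0)]
  rcases rotations_cases ((Subgroup.mul_mem_cancel_left _ hσ).1 hσ') with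
    (rfl | rfl | rfl) | (rfl | rfl | rfl)
  · simp
  · exact absurd h h₁
  · exact absurd h h₂
  · simp
  · exact absurd (by simpa using h) h₁
  · exact absurd (by simpa using h) h₂

/-- A rotation and a word describe a conjugate of `U`. -/
abbrev Label := rotations × List Bool

/-- The frame of the vertex described by a label. -/
def Label.frame (l : Label) : SL2Z := l.1 * word l.2

/-- The conjugate of `U` described by a label. -/
def Label.elt (l : Label) : SL2Z := conjShear l.frame

/-- The half-plane from which `l.elt` comes is disjoint from the half-plane to which `l'.elt`
goes. -/
def Label.Disjoint (l l' : Label) : Prop :=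
  ∀ M, 0 ≤ quad ((l.frame * letter true)⁻¹ * M) → quad ((l'.frame * letter false)⁻¹ * M) ≤ 0

theorem Label.exists_edge (l : Label) (c : Bool) :
    ∃ σ ∈ rotations, ∃ t, l.frame * letter c = σ * (U * word t) ∧ t.length = l.2.length ∧
      (t = [] ∨ ∃ t₀, t = t₀ ++ [c]) := by
  obtain ⟨⟨ρ, hρ⟩, w⟩ := l
  have key (d : Bool) (t : List Bool) : ∃ σ ∈ rotations,
      ρ * word (d :: t) = σ * (U * word t) := by
    cases d
    · refine ⟨ρ * rot⁻¹, mul_mem hρ (inv_mem rot_mem), ?_⟩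
      simp [letter, rot, mul_assoc]
    · exact ⟨ρ, hρ, by simp [letter]⟩
  cases w with
  | nil =>
    obtain ⟨σ, hσ, h⟩ := key c []
    exact ⟨σ, hσ, [], by simpa [frame] using h, rfl, .inl rfl⟩
  | cons d w =>
    obtain ⟨σ, hσ, h⟩ := key d (w ++ [c])
    exact ⟨σ, hσ, w ++ [c], by simpa [frame, mul_assoc] using h, by simp, .inr ⟨w, rfl⟩⟩

theorem HasDepth.exists_label {n : ℕ} {G : SL2Z} (h : HasDepth n G) :
    ∃ l : Label, l.2.length ≤ n ∧ l.elt = G := by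
  obtain ⟨ρ, hρ, w, hw, rfl⟩ := h
  exact ⟨(⟨ρ, hρ⟩, w), hw, rfl⟩

theorem conj_conjShear (N s : SL2Z) :
    conjShear N * conjShear (N * U * s) * (conjShear N)⁻¹ = conjShear (N * rot * s) := by
  rw [← conjShear_mul]
  congr 1
  simp only [conjShear, shear, rot]; group

theorem conj_inv_conjShear (N s : SL2Z) :
    (conjShear N)⁻¹ * conjShear (N * V⁻¹ * s) * conjShear N = conjShear (N * rot⁻¹ * s) := by
  have h := conjShear_mul (conjShear N)⁻¹ (N * V⁻¹ * s)
  rw [inv_inv] at h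
  rw [← h]
  congr 1
  simp only [conjShear, ← V_inv_conj_U, rot]; group

theorem conjShear_rotation {ρ : SL2Z} (hρ : ρ ∈ rotations) :
    conjShear ρ = U ∨ conjShear ρ = V ∨ conjShear ρ = shear := by
  have h₁ : conjShear rot = U := rot_conj_shear
  have h₂ : conjShear rot⁻¹ = V := by simpa [conjShear] using rot_inv_conj_shear
  have h₃ : conjShear 1 = shear := by simp [conjShear]
  rcases rotations_cases hρ with (rfl | rfl | rfl) | (rfl | rfl | rfl) <;> simp [h₁, h₂, h₃]

theorem conjShear_mul_conjShear_rot {ρ : SL2Z} (hρ : ρ ∈ rotations) :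
    conjShear ρ * conjShear (ρ * rot) = rot := by
  have h₁ : conjShear rot = U := rot_conj_shear
  obtain ⟨k, rfl⟩ := hρ
  have h₂ : shear * U = rot := by simp [shear, rot]
  dsimp only
  have e : rot ^ k * shear * (rot ^ k)⁻¹ * (rot ^ k * U * (rot ^ k)⁻¹) =
      rot ^ k * (shear * U) * (rot ^ k)⁻¹ := by group
  rw [conjShear_mul, h₁, conjShear, e, h₂]
  group

/-- Overlapping half-planes allow a Hurwitz move that reduces the depth, unless both elements are
short and their product is the rotation. -/
theorem Label.exists_reduction {l l' : Label} (h : ¬ l.Disjoint l') :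
    (∃ m : Label, m.2.length < l'.2.length ∧ m.elt = l.elt * l'.elt * l.elt⁻¹) ∨
    (∃ m : Label, m.2.length < l.2.length ∧ m.elt = l'.elt⁻¹ * l.elt * l'.elt) ∨
    ((l.elt = U ∨ l.elt = V ∨ l.elt = shear) ∧ l.elt * l'.elt = rot) := by
  obtain ⟨σ, hσ, t, hN, ht, htc⟩ := l.exists_edge true
  obtain ⟨σ', hσ', t', hN', ht', htc'⟩ := l'.exists_edge false
  simp only [Disjoint, not_forall, not_le] at h
  obtain ⟨M, hM, hM'⟩ := h
  rw [hN, mul_inv_rev, mul_inv_rev, mul_assoc, mul_assoc] at hM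
  rw [hN', mul_inv_rev, mul_inv_rev, mul_assoc, mul_assoc] at hM'
  have hsign := eq_or_eq_neg_of_overlap hσ hσ' M ((quad_of_word _ _).1 hM)
    ((quad_of_word _ _).2 hM')
  have hpre : t <+: t' ∨ t' <+: t := by
    have e : σ'⁻¹ * M = σ⁻¹ * M ∨ σ'⁻¹ * M = -(σ⁻¹ * M) := by
      have : (-σ)⁻¹ = -σ⁻¹ := by rw [inv_eq_iff_mul_eq_one]; simp
      rcases hsign with rfl | rfl <;> simp [this]
    rcases e with e | e <;> rw [e] at hM'
    · exact comparable_of_overlap _ _ _ hM hM'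
    · exact comparable_of_overlap _ _ _ hM (by simpa using hM')
  have helt {a b : SL2Z} (hab : a = b ∨ a = -b) : conjShear a = conjShear b := by
    rcases hab with rfl | rfl <;> simp
  have hframe (x y : SL2Z) (hxy : U * word t * x = U * word t' * y) :
      conjShear (l.frame * (U * x)) = conjShear (l'.frame * (V⁻¹ * y)) := by
    refine helt ?_
    simp only [letter] at hN hN'
    rw [← mul_assoc, ← mul_assoc, hN, hN', mul_assoc, hxy]
    rcases hsign with rfl | rfl <;> simp [mul_assoc]
  by_cases heq : t = t'
  · subst heq
    have hnil : t = [] := by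
      rcases htc with h | ⟨t₀, h⟩
      · exact h
      · rcases htc' with h' | ⟨t₁, h'⟩
        · exact h'
        · simp [h] at h'
    have hw : l.2 = [] := by simpa [hnil] using ht.symm
    have hfr : l.frame = l.1 := by simp [frame, hw]
    have e : l'.elt = conjShear (l.1 * rot) := by
      simpa [elt, rot, hfr] using (hframe V V rfl).symm
    rw [e, elt, hfr]
    exact .inr (.inr ⟨conjShear_rotation l.1.2, conjShear_mul_conjShear_rot l.1.2⟩)
  · rcases hpre with ⟨s, hs⟩ | ⟨s, hs⟩ <;>
      rcases s.eq_nil_or_concat with rfl | ⟨s, c, rfl⟩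
    · exact absurd (by simpa using hs) heq
    · left
      obtain rfl : c = false := by
        rcases htc' with h | ⟨t₀, h⟩
        · simp [h] at hs
        · rw [h, List.concat_eq_append, ← List.append_assoc] at hs; simpa using (List.append_inj' hs rfl).2
      have e : l'.elt = conjShear (l.frame * U * word s) := by
        simpa [elt, mul_assoc] using
          (hframe (word s) V (by simp [← hs, letter, mul_assoc])).symm
      obtain ⟨m, hm, hm'⟩ :=
        (hasDepth_turn l.2 s l.1 rot l.1.2 (.inl rfl)).exists_label
      refine ⟨m, ?_, ?_⟩
      · have := congrArg List.length hs
        simp at this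
        omega
      · rw [hm', e, elt, conj_conjShear, frame]
    · exact absurd (by simpa using hs.symm) heq
    · right; left
      obtain rfl : c = true := by
        rcases htc with h | ⟨t₀, h⟩
        · simp [h] at hs
        · rw [h, List.concat_eq_append, ← List.append_assoc] at hs; simpa using (List.append_inj' hs rfl).2
      have e : l.elt = conjShear (l'.frame * V⁻¹ * word s) := by
        simpa [elt, mul_assoc] using
          (hframe U⁻¹ (word s) (by simp [← hs, letter, mul_assoc]))
      obtain ⟨m, hm, hm'⟩ :=
        (hasDepth_turn l'.2 s l'.1 rot⁻¹ l'.1.2 (.inr rfl)).exists_label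
      refine ⟨m, ?_, ?_⟩
      · have := congrArg List.length hs
        simp at this
        omega
      · rw [hm', e, elt, conj_inv_conjShear, frame]

theorem Label.quad_rotation_nonpos (l : Label) {ρ : SL2Z} (hρ : ρ ∈ rotations) :
    quad ((l.frame * letter false)⁻¹ * ρ) ≤ 0 := by
  obtain ⟨σ, hσ, t, hN, -⟩ := l.exists_edge false
  by_contra! h
  rw [hN, mul_inv_rev, mul_inv_rev, mul_assoc, mul_assoc] at h
  replace h := (quad_of_word _ _).2 h
  rw [quad_U_inv_mul] at h
  rcases rotations_cases (mul_mem (inv_mem hσ) hρ) with (e | e | e) | (e | e | e) <;>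
    rw [e] at h <;>
    simp [rot, coe_U, coe_V, Matrix.mul_apply, Fin.sum_univ_two, Matrix.adjugate_fin_two] at h

theorem Label.exists_quad_rotation_neg (l : Label) :
    ∃ ρ ∈ rotations, quad ((l.frame * letter true)⁻¹ * ρ) < 0 := by
  obtain ⟨σ, hσ, t, hN, -⟩ := l.exists_edge true
  refine ⟨σ * rot, mul_mem hσ rot_mem, ?_⟩
  by_contra! h
  rw [hN, mul_inv_rev, mul_inv_rev, mul_assoc, mul_assoc] at h
  replace h := (quad_of_word _ _).1 h
  have e : U⁻¹ * (σ⁻¹ * (σ * rot)) = V * 1 := by simp [rot]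
  rw [e, quad_V_mul] at h
  simp at h

theorem Label.quad_elt_inv_mul (l : Label) (M : SL2Z)
    (h : quad ((l.frame * letter false)⁻¹ * M) ≤ 0) :
    0 ≤ quad ((l.frame * letter true)⁻¹ * (l.elt⁻¹ * M)) := by
  have e₁ : (l.frame * letter false)⁻¹ * M = V * (l.frame⁻¹ * M) := by
    simp [letter, mul_assoc]
  have e₂ : (l.frame * letter true)⁻¹ * (l.elt⁻¹ * M) = rot⁻¹ * (l.frame⁻¹ * M) := by
    simp only [letter, elt, conjShear, shear, rot]; group
  rw [e₁, quad_V_mul] at h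
  rw [e₂, quad_rot_inv_mul]
  linarith

theorem exists_forall_quad_nonneg (l : Label) (Λ : List Label)
    (h : (l :: Λ).IsChain Label.Disjoint) :
    ∃ m : Label, ∀ M, quad ((l.frame * letter false)⁻¹ * M) ≤ 0 →
      0 ≤ quad ((m.frame * letter true)⁻¹ * (((l :: Λ).map Label.elt).prod⁻¹ * M)) := by
  induction Λ generalizing l with
  | nil => exact ⟨l, fun M hM => by simpa using l.quad_elt_inv_mul M hM⟩
  | cons l' Λ ih =>
    rw [List.isChain_cons_cons] at h
    obtain ⟨m, hm⟩ := ih l' h.2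
    refine ⟨m, fun M hM => ?_⟩
    have := hm _ (h.1 _ (l.quad_elt_inv_mul M hM))
    simpa [mul_assoc] using this

theorem not_isChain_of_prod_mem {Λ : List Label} (hΛ : Λ ≠ [])
    (hprod : (Λ.map Label.elt).prod ∈ rotations) : ¬ Λ.IsChain Label.Disjoint := by
  obtain ⟨l, Λ, rfl⟩ := List.exists_cons_of_ne_nil hΛ
  intro h
  obtain ⟨m, hm⟩ := exists_forall_quad_nonneg l Λ h
  obtain ⟨ρ, hρ, hneg⟩ := m.exists_quad_rotation_neg
  have := hm _ (l.quad_rotation_nonpos (mul_mem hprod hρ))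
  rw [inv_mul_cancel_left] at this
  exact absurd this (not_le.2 hneg)

/-! ### Normal forms -/

theorem hurwitzEquiv_pair {g h : SL2Z} (hg : g = U ∨ g = V ∨ g = shear) (hgh : g * h = rot)
    (D : List SL2Z) : HurwitzEquiv (g :: h :: D) (U :: V :: D) := by
  have hVS : V * shear = rot := by rw [← V_inv_conj_U, rot]; group
  have hSU : shear * U = rot := by simp [shear, rot]
  have hV : HurwitzEquiv (V :: shear :: D) (U :: V :: D) := by
    have := HurwitzEquiv.swap_left V shear D
    rwa [hVS, rot, mul_inv_cancel_right] at this
  rcases hg with rfl | rfl | rfl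
  · rw [rot, mul_right_inj] at hgh
    rw [hgh]
    exact .refl
  · rw [← hVS, mul_right_inj] at hgh
    rwa [hgh]
  · rw [← hSU, mul_right_inj] at hgh
    rw [hgh]
    have := HurwitzEquiv.swap_left shear U D
    rw [hSU, ← hVS, mul_inv_cancel_right] at this
    exact this.trans hV

theorem exists_hurwitzEquiv_of_labels (n : ℕ) : ∀ Λ : List Label,
    (Λ.map fun l => l.2.length).sum = n → Λ ≠ [] → (Λ.map Label.elt).prod ∈ rotations →
    ∃ D, HurwitzEquiv (Λ.map Label.elt) (U :: V :: D) := by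
  induction n using Nat.strong_induction_on with
  | _ n ih =>
    intro Λ hn hΛ hprod
    obtain ⟨p, l, l', t, rfl, hl⟩ :=
      List.exists_append_of_not_isChain (not_isChain_of_prod_mem hΛ hprod)
    have next (Λ' : List Label) (hlt : (Λ'.map fun l => l.2.length).sum < n) (hne : Λ' ≠ [])
        (he : HurwitzEquiv ((p ++ l :: l' :: t).map Label.elt) (Λ'.map Label.elt)) :
        ∃ D, HurwitzEquiv ((p ++ l :: l' :: t).map Label.elt) (U :: V :: D) := by
      obtain ⟨D, hD⟩ := ih _ hlt Λ' rfl hne (he.prod_eq ▸ hprod)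
      exact ⟨D, he.trans hD⟩
    rcases Label.exists_reduction hl with ⟨m, hm, hm'⟩ | ⟨m, hm, hm'⟩ | ⟨hg, hgh⟩
    · refine next (p ++ m :: l :: t) ?_ (by simp) ?_
      · simp at hn ⊢; omega
      · simpa [hm'] using (HurwitzEquiv.swap_left l.elt l'.elt (t.map Label.elt)).append_left
          (p.map Label.elt)
    · refine next (p ++ l' :: m :: t) ?_ (by simp) ?_
      · simp at hn ⊢; omega
      · simpa [hm'] using (HurwitzEquiv.swap_right l.elt l'.elt (t.map Label.elt)).append_left
          (p.map Label.elt)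
    · obtain ⟨D, hD⟩ := HurwitzEquiv.exists_pair_to_front (p.map Label.elt) l.elt l'.elt
        (t.map Label.elt)
      refine ⟨D, ?_⟩
      rw [List.map_append]
      exact hD.trans (hurwitzEquiv_pair hg hgh D)

theorem exists_hurwitzEquiv {L : List SL2Z} (hconj : ∀ A ∈ L, IsConj U A) (hL : L ≠ [])
    (hprod : L.prod ∈ rotations) : ∃ D, HurwitzEquiv L (U :: V :: D) := by
  obtain ⟨Λ, rfl⟩ : ∃ Λ : List Label, L = Λ.map Label.elt := by
    have : ∀ A ∈ L, A ∈ Set.range Label.elt := fun A hA => by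
      obtain ⟨n, hn⟩ := exists_hasDepth (hconj A hA)
      obtain ⟨l, -, hl⟩ := hn.exists_label
      exact ⟨l, hl⟩
    obtain ⟨Λ, hΛ⟩ : L ∈ Set.range (List.map Label.elt) := by rwa [Set.range_list_map]
    exact ⟨Λ, hΛ.symm⟩
  exact exists_hurwitzEquiv_of_labels _ Λ rfl (by simpa using hL) hprod

theorem rot_ne_one : rot ≠ 1 := by
  intro h
  have := congrArg (fun M : SL2Z => M 0 0) h
  simp [rot, coe_U, coe_V, Matrix.mul_apply, Fin.sum_univ_two] at this

theorem rot_sq_ne_one : rot ^ 2 ≠ 1 := by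
  intro h
  have := congrArg (fun M : SL2Z => M 0 0) h
  simp [rot, coe_U, coe_V, Matrix.mul_apply, Fin.sum_univ_two, pow_two] at this

theorem exists_hurwitzEquiv_of_prod_eq_rot_sq {L : List SL2Z} (hconj : ∀ A ∈ L, IsConj U A)
    (hprod : L.prod = rot ^ 2) : ∃ D, HurwitzEquiv L (U :: V :: U :: V :: D) := by
  obtain ⟨D, hD⟩ := exists_hurwitzEquiv hconj
    (by rintro rfl; exact rot_sq_ne_one hprod.symm) (hprod ▸ pow_mem rot_mem 2)
  have hDprod : D.prod = rot := by
    have := hD.prod_eq.trans hprod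
    simpa [pow_two, rot, mul_assoc] using this
  obtain ⟨E, hE⟩ := exists_hurwitzEquiv (L := D)
    (fun A hA => hD.forall_isConj hconj A (by simp [hA]))
    (by rintro rfl; exact rot_ne_one hDprod.symm) (hDprod ▸ rot_mem)
  exact ⟨E, hD.trans ((hE.cons V).cons U)⟩

end SL2Z

/-- Kodaira type IV: any factorization of `(VU)²` into conjugates of `U` has `r ≥ 4` factors and Hurwitz moves bring it to `(V, U, V, U, D₅, …, Dᵣ)` with `D₅⋯Dᵣ = 1`. -/
theorem normal_factorization_IV (L : List SL2Z)
    (hconj : ∀ A ∈ L, IsConj U A)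
    (hprod : L.prod = (V * U) ^ 2) :
    4 ≤ L.length ∧
    ∃ D : List SL2Z,
      HurwitzEquiv L ([V, U, V, U] ++ D) ∧ D.prod = 1 := by
  suffices ∃ D, HurwitzEquiv L ([V, U, V, U] ++ D) by
    obtain ⟨D, hD⟩ := this
    refine ⟨?_, D, hD, ?_⟩
    · rw [← hD.length_eq]; simp
    · have := hD.prod_eq.trans hprod
      rw [List.prod_append] at this
      simpa [pow_two, mul_assoc] using this
  have hconj' : ∀ A ∈ L.map (MulAut.conj U).toMonoidHom, IsConj U A := by
    intro A hA
    obtain ⟨B, hB, rfl⟩ := List.mem_map.1 hA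
    exact (hconj B hB).trans (isConj_iff.2 ⟨U, rfl⟩)
  obtain ⟨D, hD⟩ := SL2Z.exists_hurwitzEquiv_of_prod_eq_rot_sq hconj' (by
    rw [← map_list_prod, hprod]
    simp [SL2Z.rot, pow_two, mul_assoc])
  have h := hD.map (MulAut.conj U⁻¹).toMonoidHom
  have e : (L.map (MulAut.conj U).toMonoidHom).map (MulAut.conj U⁻¹).toMonoidHom = L := by
    simp [Function.comp_def, mul_assoc]
  rw [e] at h
  refine ⟨D.map (MulAut.conj U⁻¹).toMonoidHom, h.trans ?_⟩
  have step (t : List SL2Z) : HurwitzEquiv (U :: (U⁻¹ * V * U) :: t) (V :: U :: t) := by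
    simpa [mul_assoc] using HurwitzEquiv.swap_left U (U⁻¹ * V * U) t
  simpa using (step _).trans (((step _).cons U).cons V)
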